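/- Let (W, {s_i}_{i∈I}) be a Coxeter system with length function ℓ, and let S ⊆ I. Let w_S ∈ W_S with ℓ(w_S) ≥ 2 and w^S ∈ W^S. Suppose w' ∈ W is such that w_S w^S → w' holds, i.e., there exists a reflection t ∈ T with w_S w^S = t w' and ℓ(w_S w^S) = ℓ(w') + 1. Then w' ∉ W^S, i.e., there exists v ∈ W_S with ℓ(v w') < ℓ(w'). -/

import Mathlib

open Classical in
/-- The basic signed conjugation permutation attached to a simple reflection. -/
noncomputable def sgnPerm {B W : Type*} [Group W] {M : CoxeterMatrix B} (cs : CoxeterSystem M W)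
    (i : B) : Equiv.Perm (W × ZMod 2) :=
  Function.Involutive.toPerm
    (fun x => (cs.simple i * x.1 * cs.simple i, x.2 + if x.1 = cs.simple i then 1 else 0))
    (by
      rintro ⟨t, e⟩
      have h : cs.simple i * t * cs.simple i = cs.simple i ↔ t = cs.simple i := by
        constructor
        · intro h
          have h2 : cs.simple i * t = 1 := by simpa using h
          have h3 := eq_inv_of_mul_eq_one_right h2
          simpa using h3
        · rintro rfl
          simp
      have h1 : cs.simple i * (cs.simple i * t * cs.simple i) * cs.simple i = t := by
        simp [mul_assoc]
      have h0 : (1 : ZMod 2) + 1 = 0 := by decide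
      simp only [h, h1, Prod.mk.injEq, true_and]
      split_ifs
      · rw [add_assoc, h0, add_zero]
      · simp)

open Classical in
theorem sgnPerm_apply {B W : Type*} [Group W] {M : CoxeterMatrix B} (cs : CoxeterSystem M W)
    (i : B) (t : W) (e : ZMod 2) : sgnPerm cs i (t, e) =
      (cs.simple i * t * cs.simple i, e + if t = cs.simple i then 1 else 0) := rfl

theorem simple_pow_swap {B W : Type*} [Group W] {M : CoxeterMatrix B} (cs : CoxeterSystem M W)
    (i j : B) (k : ℕ) : (cs.simple i * cs.simple j) ^ k * cs.simple j * (cs.simple i * cs.simple j) ^ k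
      = cs.simple j := by
  induction k with
  | zero => simp
  | succ k ih =>
    rw [pow_succ]
    nth_rewrite 2 [(pow_succ (cs.simple i * cs.simple j) k).symm]
    rw [pow_succ']
    calc _ = (cs.simple i * cs.simple j) ^ k * cs.simple i * (cs.simple j * cs.simple j) * cs.simple i * cs.simple j * (cs.simple i * cs.simple j) ^ k := by
            simp only [mul_assoc]
      _ = (cs.simple i * cs.simple j) ^ k * cs.simple j * (cs.simple i * cs.simple j) ^ k := by
            simp [mul_assoc]
      _ = _ := ih

open Classical in
theorem sgnPerm_pow {B W : Type*} [Group W] {M : CoxeterMatrix B} (cs : CoxeterSystem M W)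
    (i j : B) (k : ℕ) (t : W) (e : ZMod 2) :
    ((sgnPerm cs i * sgnPerm cs j) ^ k) (t, e) =
      ((cs.simple i * cs.simple j) ^ k * t * ((cs.simple i * cs.simple j) ^ k)⁻¹,
        e + ∑ l ∈ Finset.range (2 * k),
          if t = cs.simple j * (cs.simple i * cs.simple j) ^ l then 1 else 0) := by
  induction k with
  | zero => simp
  | succ k ih =>
    rw [pow_succ' (sgnPerm cs i * sgnPerm cs j), Equiv.Perm.mul_apply, ih, Equiv.Perm.mul_apply, sgnPerm_apply,
      sgnPerm_apply, show 2 * (k + 1) = 2 * k + 1 + 1 by ring, Finset.sum_range_succ,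
      Finset.sum_range_succ]
    have hsw := simple_pow_swap cs i j k
    have e1 : (cs.simple i * cs.simple j) ^ k * t * ((cs.simple i * cs.simple j) ^ k)⁻¹
        = cs.simple j ↔ t = cs.simple j * (cs.simple i * cs.simple j) ^ (2 * k) := by
      rw [mul_inv_eq_iff_eq_mul, ← eq_inv_mul_iff_mul_eq, two_mul, pow_add]
      have : ((cs.simple i * cs.simple j) ^ k)⁻¹ * (cs.simple j * (cs.simple i * cs.simple j) ^ k)
        = cs.simple j * ((cs.simple i * cs.simple j) ^ k * (cs.simple i * cs.simple j) ^ k) := by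
        rw [inv_mul_eq_iff_eq_mul]
        nth_rewrite 1 [← hsw]
        simp only [mul_assoc]
      rw [this]
    have e2 : cs.simple j * ((cs.simple i * cs.simple j) ^ k * t *
        ((cs.simple i * cs.simple j) ^ k)⁻¹) * cs.simple j
        = cs.simple i ↔ t = cs.simple j * (cs.simple i * cs.simple j) ^ (2 * k + 1) := by
      have a1 : cs.simple j * ((cs.simple i * cs.simple j) ^ k * t *
        ((cs.simple i * cs.simple j) ^ k)⁻¹) * cs.simple j
        = cs.simple i ↔ (cs.simple i * cs.simple j) ^ k * t *
        ((cs.simple i * cs.simple j) ^ k)⁻¹ = cs.simple j * cs.simple i * cs.simple j := by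
        constructor
        · intro h
          have h' := congrArg (fun x => cs.simple j * x * cs.simple j) h
          simpa [mul_assoc] using h'
        · intro h
          rw [h]
          simp [mul_assoc]
      rw [a1, mul_inv_eq_iff_eq_mul, ← eq_inv_mul_iff_mul_eq]
      have : ((cs.simple i * cs.simple j) ^ k)⁻¹ *
          (cs.simple j * cs.simple i * cs.simple j * (cs.simple i * cs.simple j) ^ k)
        = cs.simple j * (cs.simple i * cs.simple j) ^ (2 * k + 1) := by
        rw [inv_mul_eq_iff_eq_mul, show 2 * k + 1 = k + (1 + k) by ring, pow_add, pow_add, pow_one]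
        nth_rewrite 1 [← hsw]
        simp only [mul_assoc]
      rw [this]
    simp only [e1, e2]
    refine Prod.ext ?_ ?_
    · simp [pow_succ', mul_assoc]
    · simp [add_assoc]

theorem sgnPerm_liftable {B W : Type*} [Group W] {M : CoxeterMatrix B} (cs : CoxeterSystem M W) :
    M.IsLiftable (sgnPerm cs) := by
  classical
  intro i j
  ext1 ⟨t, e⟩
  rw [sgnPerm_pow, two_mul, Finset.sum_range_add]
  simp only [pow_add, cs.simple_mul_simple_pow, one_mul]
  rw [CharTwo.add_self_eq_zero]
  simp

open Classical in
theorem lift_wordProd {B W : Type*} [Group W] {M : CoxeterMatrix B} (cs : CoxeterSystem M W)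
    (ω : List B) (t : W) (e : ZMod 2) :
    cs.lift ⟨sgnPerm cs, sgnPerm_liftable cs⟩ (cs.wordProd ω) (t, e) =
      (cs.wordProd ω * t * (cs.wordProd ω)⁻¹, e + ((cs.rightInvSeq ω).count t : ℕ)) := by
  induction ω with
  | nil => simp
  | cons i ω ih =>
    rw [cs.wordProd_cons, map_mul, Equiv.Perm.mul_apply, ih, cs.lift_apply_simple, sgnPerm_apply]
    refine Prod.ext ?_ ?_
    · simp [mul_assoc]
    · have h : cs.wordProd ω * t * (cs.wordProd ω)⁻¹ = cs.simple i ↔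
        (cs.wordProd ω)⁻¹ * cs.simple i * cs.wordProd ω = t := by
        rw [mul_inv_eq_iff_eq_mul, ← eq_inv_mul_iff_mul_eq, ← mul_assoc, eq_comm]
      simp only [h, CoxeterSystem.rightInvSeq, List.count_cons, beq_iff_eq]
      push_cast
      rw [add_assoc]

/-- additive translation -/
theorem lift_snd {B W : Type*} [Group W] {M : CoxeterMatrix B} (cs : CoxeterSystem M W)
    (w t : W) (e : ZMod 2) :
    cs.lift ⟨sgnPerm cs, sgnPerm_liftable cs⟩ w (t, e) =
      (w * t * w⁻¹, e + (cs.lift ⟨sgnPerm cs, sgnPerm_liftable cs⟩ w (t, 0)).2) := by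
  classical
  obtain ⟨ω, -, rfl⟩ := cs.exists_isReduced w
  simp [lift_wordProd]

theorem lift_reflection {B W : Type*} [Group W] {M : CoxeterMatrix B} (cs : CoxeterSystem M W)
    (t : W) (ht : cs.IsReflection t) :
    (cs.lift ⟨sgnPerm cs, sgnPerm_liftable cs⟩ t (t, 0)).2 = 1 := by
  classical
  obtain ⟨w, i, rfl⟩ := ht
  set F := cs.lift ⟨sgnPerm cs, sgnPerm_liftable cs⟩ with hF
  have h1 : F w⁻¹ (w * cs.simple i * w⁻¹, 0) = (cs.simple i, (F w⁻¹ (w * cs.simple i * w⁻¹, 0)).2) := by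
    rw [hF, lift_snd]
    simp [mul_assoc]
  set c := (F w⁻¹ (w * cs.simple i * w⁻¹, 0)).2 with hc
  have h2 : F w (cs.simple i, c) = (w * cs.simple i * w⁻¹, 0) := by
    rw [← h1, ← Equiv.Perm.mul_apply, ← map_mul]
    simp
  have h3 : F (cs.simple i) (cs.simple i, c) = (cs.simple i, c + 1) := by
    rw [hF, cs.lift_apply_simple, sgnPerm_apply]
    simp
  have h4 := lift_snd cs w (cs.simple i) c
  have h5 := lift_snd cs w (cs.simple i) (c + 1)
  rw [← hF] at h4 h5
  rw [map_mul, map_mul, Equiv.Perm.mul_apply, Equiv.Perm.mul_apply, h1, h3, h5]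
  rw [h2] at h4
  have h6 := congrArg Prod.snd h4
  simp only at h6 ⊢
  rw [add_right_comm, ← h6, zero_add]

/-- Strong exchange, right version. -/
theorem strong_exchange_right {B W : Type*} [Group W] {M : CoxeterMatrix B}
    (cs : CoxeterSystem M W) (ω : List B) (t : W) (ht : cs.IsReflection t)
    (hl : cs.length (cs.wordProd ω * t) < cs.length (cs.wordProd ω)) :
    t ∈ cs.rightInvSeq ω := by
  classical
  by_contra hn
  obtain ⟨τ, hτ, hτ'⟩ := cs.exists_isReduced (cs.wordProd ω * t)
  have h1 := lift_wordProd cs τ t 0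
  rw [← hτ', map_mul, Equiv.Perm.mul_apply, lift_snd cs t, lift_reflection cs t ht,
    lift_wordProd, mul_inv_cancel_right, List.count_eq_zero_of_not_mem hn] at h1
  have h2 := congrArg Prod.snd h1
  simp only at h2
  have hm : t ∈ cs.rightInvSeq τ := by
    by_contra hm
    rw [List.count_eq_zero_of_not_mem hm] at h2
    revert h2
    simp
  have h3 := (cs.isRightInversion_of_mem_rightInvSeq hτ hm).2
  rw [← hτ', mul_assoc, ht.mul_self, mul_one] at h3
  omega

/-- Strong exchange, left version. -/
theorem strong_exchange_left {B W : Type*} [Group W] {M : CoxeterMatrix B}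
    (cs : CoxeterSystem M W) (ω : List B) (t : W) (ht : cs.IsReflection t)
    (hl : cs.length (t * cs.wordProd ω) < cs.length (cs.wordProd ω)) :
    ∃ j < ω.length, t * cs.wordProd ω = cs.wordProd (ω.eraseIdx j) := by
  have h : t ∈ cs.rightInvSeq ω.reverse := by
    apply strong_exchange_right cs _ t ht
    rw [cs.wordProd_reverse, cs.length_inv, ← cs.length_inv]
    simpa [ht.inv] using hl
  rw [cs.rightInvSeq_reverse, List.mem_reverse] at h
  obtain ⟨j, hj, rfl⟩ := List.mem_iff_getElem.1 h
  refine ⟨j, by simpa using hj, ?_⟩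
  rw [← cs.getD_leftInvSeq_mul_wordProd, List.getD_eq_getElem _ _ hj]

theorem wordProd_mem_closure {B W : Type*} [Group W] {M : CoxeterMatrix B}
    (cs : CoxeterSystem M W) (S : Set B) (ω : List B) (h : ∀ i ∈ ω, i ∈ S) :
    cs.wordProd ω ∈ Subgroup.closure (cs.simple '' S) := by
  induction ω with
  | nil => simp
  | cons i ω ih =>
    rw [cs.wordProd_cons]
    refine mul_mem (Subgroup.subset_closure ⟨i, h i (by simp), rfl⟩) (ih fun k hk => h k (by simp [hk]))

theorem exists_word_of_mem {B W : Type*} [Group W] {M : CoxeterMatrix B}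
    (cs : CoxeterSystem M W) (S : Set B) (w : W) (hw : w ∈ Subgroup.closure (cs.simple '' S)) :
    ∃ ω : List B, (∀ i ∈ ω, i ∈ S) ∧ cs.wordProd ω = w := by
  induction hw using Subgroup.closure_induction with
  | mem x hx =>
    obtain ⟨i, hi, rfl⟩ := hx
    exact ⟨[i], by simpa using hi, by simp⟩
  | one => exact ⟨[], by simp, by simp⟩
  | mul x y _ _ hx hy =>
    obtain ⟨a, ha, rfl⟩ := hx
    obtain ⟨b, hb, rfl⟩ := hy
    refine ⟨a ++ b, ?_, by simp [cs.wordProd_append]⟩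
    intro i hi
    rcases List.mem_append.1 hi with h | h
    · exact ha i h
    · exact hb i h
  | inv x _ hx =>
    obtain ⟨a, ha, rfl⟩ := hx
    exact ⟨a.reverse, by simpa using ha, by simp⟩

/-- Exchange in a product `ω * u`. -/
theorem exchange_split {B W : Type*} [Group W] {M : CoxeterMatrix B}
    (cs : CoxeterSystem M W) (ω : List B) (u t : W) (ht : cs.IsReflection t)
    (hl : cs.length (t * (cs.wordProd ω * u)) < cs.length (cs.wordProd ω * u)) :
    (∃ j < ω.length, t * (cs.wordProd ω * u) = cs.wordProd (ω.eraseIdx j) * u) ∨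
    (∃ u', cs.length u' < cs.length u ∧ t * (cs.wordProd ω * u) = cs.wordProd ω * u') := by
  obtain ⟨τ, hτ, rfl⟩ := cs.exists_isReduced u
  rw [← cs.wordProd_append] at hl ⊢
  obtain ⟨j, hj, h⟩ := strong_exchange_left cs _ t ht hl
  rw [h]
  by_cases hjω : j < ω.length
  · left
    exact ⟨j, hjω, by rw [List.eraseIdx_append_of_lt_length hjω, cs.wordProd_append]⟩
  · right
    rw [List.length_append] at hj
    refine ⟨cs.wordProd (τ.eraseIdx (j - ω.length)), ?_, ?_⟩
    · have h1 := cs.length_wordProd_le (τ.eraseIdx (j - ω.length))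
      rw [List.length_eraseIdx_of_lt (by omega)] at h1
      rw [hτ.eq]
      omega
    · rw [List.eraseIdx_append_of_length_le (by omega), cs.wordProd_append]

theorem length_additive {B W : Type*} [Group W] {M : CoxeterMatrix B}
    (cs : CoxeterSystem M W) (S : Set B) (u : W)
    (hu : ∀ v ∈ Subgroup.closure (cs.simple '' S), cs.length (v * u) ≥ cs.length u)
    (ω : List B) (hS : ∀ i ∈ ω, i ∈ S)
    (hmin : ∀ τ : List B, (∀ i ∈ τ, i ∈ S) → cs.wordProd τ = cs.wordProd ω → ω.length ≤ τ.length) :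
    cs.length (cs.wordProd ω * u) = ω.length + cs.length u := by
  induction ω with
  | nil => simp
  | cons i ω ih =>
    have hS' : ∀ k ∈ ω, k ∈ S := fun k hk => hS k (by simp [hk])
    have hi : i ∈ S := hS i (by simp)
    have ih := ih hS' (by
      intro τ hτ h
      have := hmin (i :: τ) (by
        intro k hk
        rcases List.mem_cons.1 hk with rfl | hk
        · exact hi
        · exact hτ k hk) (by rw [cs.wordProd_cons, cs.wordProd_cons, h])
      simpa using this)
    rw [cs.wordProd_cons, mul_assoc]
    rcases cs.length_simple_mul (cs.wordProd ω * u) i with h | h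
    · rw [h, ih, List.length_cons]
      ring
    · exfalso
      rcases exchange_split cs ω u _ (cs.isReflection_simple i) (by omega) with
        ⟨j, hj, h2⟩ | ⟨u', hu', h2⟩
      · rw [← mul_assoc, mul_left_inj, ← cs.wordProd_cons] at h2
        have := hmin _ (fun k hk => hS' k (List.mem_of_mem_eraseIdx hk)) h2.symm
        rw [List.length_eraseIdx_of_lt hj, List.length_cons] at this
        omega
      · have hv := wordProd_mem_closure cs S ω hS'
        have h3 : u' = ((cs.wordProd ω)⁻¹ * cs.simple i * cs.wordProd ω) * u := by
          rw [← inv_mul_eq_iff_eq_mul] at h2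
          rw [← h2]
          simp only [mul_assoc]
        have := hu _ (mul_mem (mul_mem (inv_mem hv) (Subgroup.subset_closure ⟨i, hi, rfl⟩)) hv)
        rw [← h3] at this
        omega

/-- Combinatorial claim used in the proof of Lemma 3.5 of Heckenberger–Kolb, in the
case `ℓ(w_S) ≥ 2`: if `w_S ∈ W_S` with `ℓ(w_S) ≥ 2`, `w^S ∈ W^S` and
`w_S w^S → w'`, then `w' ∉ W^S`. -/
theorem arrow_target_not_min_coset_rep_of_two_le_length
    {B W : Type*} [Group W] {M : CoxeterMatrix B} (cs : CoxeterSystem M W)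
    (S : Set B)
    (wS : W) (hwS : wS ∈ Subgroup.closure (cs.simple '' S))
    (hlenS : 2 ≤ cs.length wS)
    (wUpS : W)
    (hwUpS : ∀ v ∈ Subgroup.closure (cs.simple '' S),
      cs.length (v * wUpS) ≥ cs.length wUpS)
    (w' : W)
    (t : W) (ht : cs.IsReflection t)
    (heq : wS * wUpS = t * w')
    (hlen : cs.length (wS * wUpS) = cs.length w' + 1) :
    ∃ v ∈ Subgroup.closure (cs.simple '' S),
      cs.length (v * w') < cs.length w' := by
  classical
  have hex : ∃ n, ∃ ω : List B, ω.length = n ∧ (∀ i ∈ ω, i ∈ S) ∧ cs.wordProd ω = wS := by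
    obtain ⟨ω, h⟩ := exists_word_of_mem cs S wS hwS
    exact ⟨_, ω, rfl, h⟩
  obtain ⟨ω, hn, hS, hω⟩ := Nat.find_spec hex
  have hadd := length_additive cs S wUpS hwUpS ω hS (by
    intro τ hτ h
    rw [hn]
    exact Nat.find_min' hex ⟨τ, rfl, hτ, h.trans hω⟩)
  have hle := cs.length_wordProd_le ω
  have hw' : w' = t * (cs.wordProd ω * wUpS) := by
    rw [hω, heq, ← mul_assoc, ht.mul_self, one_mul]
  rw [hω] at hadd hle
  rcases exchange_split cs ω wUpS t ht (by rw [← hw', hω]; omega) with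
    ⟨j, hj, h2⟩ | ⟨u', hu', h2⟩
  · refine ⟨(cs.wordProd (ω.eraseIdx j))⁻¹, inv_mem (wordProd_mem_closure cs S _
      fun k hk => hS k (List.mem_of_mem_eraseIdx hk)), ?_⟩
    have : (cs.wordProd (ω.eraseIdx j))⁻¹ * w' = wUpS := by rw [hw', h2, inv_mul_cancel_left]
    rw [this]
    omega
  · refine ⟨wS⁻¹, inv_mem hwS, ?_⟩
    have : wS⁻¹ * w' = u' := by rw [hw', h2, hω, inv_mul_cancel_left]
    rw [this]
    omega
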